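/- arXiv:2206.02031 — 2 statements merged into one kernel-verified Lean document; each statement's English description precedes it below -/
import Mathlib

section
/- Let n > 0 be a natural number, and let f, g : ℝ → ℝ be functions possessing derivatives up to order n. Then the n-th derivative of the composition x ↦ f(g(x)) satisfies: (f ∘ g)⁽ⁿ⁾(x) = ∑_{π ∈ Π_n} f^(|π|)(g(x)) · ∏_{B ∈ π} g^(|B|)(x), where Π_n is the set of all partitions of {1, …, n}, |π| denotes the number of blocks of the partition π, and B ranges over the blocks of π. -/
open Finset in
/-- Add a new element `a` to the block `B` of a partition `P` of `s`; the choice `B = ∅` creates the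
new block `{a}`. -/
def Finpartition.insertInto {α : Type*} [DecidableEq α] {s : Finset α} (P : Finpartition s) {a : α}
    (ha : a ∉ s) {B : Finset α} (hB : B ∈ insert ∅ P.parts) : Finpartition (insert a s) :=
  Finpartition.ofExistsUnique (insert (insert a B) (P.parts.erase B))
    (by
      have := fun p (hp : p ∈ P.parts) ↦ P.subset hp
      grind)
    (by
      intro b hb
      rcases eq_or_ne b a with rfl | hba
      · refine ⟨insert b B, by simp, ?_⟩
        have := fun p (hp : p ∈ P.parts) ↦ P.subset hp
        grind
      · obtain ⟨t, ⟨ht, hbt⟩, hu⟩ := P.existsUnique_mem (mem_of_mem_insert_of_ne hb hba)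
        by_cases htB : t = B
        · exact ⟨insert a B, by grind, by grind⟩
        · exact ⟨t, by grind, by grind⟩)
    (by
      have := P.empty_notMem_parts
      grind [Finset.insert_ne_empty])

open Finset in
/-- Every partition of `insert a s` arises exactly once from a partition of `s` by adding `a` to
one of its blocks or as a new singleton block. -/
theorem Finpartition.sum_insert {α M : Type*} [DecidableEq α] [AddCommMonoid M] {s : Finset α}
    {a : α} (ha : a ∉ s) (F : Finset (Finset α) → M) :
    ∑ Q : Finpartition (insert a s), F Q.parts =
      ∑ P : Finpartition s, (F (insert {a} P.parts) +
        ∑ B ∈ P.parts, F (insert (insert a B) (P.parts.erase B))) := by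
  have key : ∀ P : Finpartition s, F (insert {a} P.parts) +
      ∑ B ∈ P.parts, F (insert (insert a B) (P.parts.erase B)) =
      ∑ B ∈ insert ∅ P.parts, F (insert (insert a B) (P.parts.erase B)) := fun P ↦ by
    rw [Finset.sum_insert P.empty_notMem_parts, erase_eq_of_notMem P.empty_notMem_parts,
      insert_empty]
  simp_rw [key]
  rw [Finset.sum_sigma']
  symm
  refine Finset.sum_bij (fun x hx ↦ x.1.insertInto ha (mem_sigma.1 hx).2) (by simp) ?_ ?_ ?_
  · rintro ⟨P, B⟩ hB ⟨P', B'⟩ hB' h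
    have h : insert (insert a B) (P.parts.erase B) = insert (insert a B') (P'.parts.erase B') :=
      congrArg Finpartition.parts h
    simp only [mem_sigma, mem_univ, true_and] at hB hB'
    have hP : ∀ p ∈ P.parts, a ∉ p := fun p hp hap ↦ ha (P.subset hp hap)
    have hP' : ∀ p ∈ P'.parts, a ∉ p := fun p hp hap ↦ ha (P'.subset hp hap)
    have haB : a ∉ B := by grind
    have haB' : a ∉ B' := by grind
    have hBB : insert a B = insert a B' := by
      have : insert a B ∈ insert (insert a B') (P'.parts.erase B') := h ▸ mem_insert_self _ _
      grind
    obtain rfl : B = B' := by rw [← erase_insert haB, hBB, erase_insert haB']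
    have hE : P.parts.erase B = P'.parts.erase B := by
      rw [← erase_insert (a := insert a B) (s := P.parts.erase B) (by grind), h,
        erase_insert (by grind)]
    have h0 := P.empty_notMem_parts
    have h0' := P'.empty_notMem_parts
    obtain rfl : P = P' := by
      ext1
      ext t
      have := congrArg (t ∈ ·) hE
      grind
    rfl
  · intro Q _
    have haQ : Q.part a ∈ Q.parts := Q.part_mem.2 (mem_insert_self a s)
    have haa : a ∈ Q.part a := Q.mem_part_self.2 (mem_insert_self a s)
    have hsub := fun p (hp : p ∈ Q.parts) ↦ Q.subset hp
    have hne := Q.empty_notMem_parts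
    have huniq : ∀ p ∈ Q.parts, ∀ b, b ∈ p → ∀ q ∈ Q.parts, b ∈ q → p = q :=
      fun p hp b hbp q hq hbq ↦ Q.eq_of_mem_parts hp hq hbp hbq
    set A := Q.part a
    let P : Finpartition s :=
      Finpartition.ofExistsUnique ((insert (A.erase a) (Q.parts.erase A)).erase ∅)
        (by grind)
        (by
          intro b hb
          obtain ⟨t, ⟨ht, hbt⟩, hu⟩ := Q.existsUnique_mem (mem_insert_of_mem hb)
          by_cases htA : t = A
          · exact ⟨A.erase a, by grind, by grind⟩
          · exact ⟨t, by grind, by grind⟩)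
        (by simp)
    have hPp : P.parts = (insert (A.erase a) (Q.parts.erase A)).erase ∅ := rfl
    have hmem : A.erase a ∈ insert ∅ P.parts := by grind
    refine ⟨⟨P, A.erase a⟩, by simpa using hmem, ?_⟩
    ext1
    change insert (insert a (A.erase a)) (P.parts.erase (A.erase a)) = Q.parts
    rw [insert_erase haa, hPp]
    have hnot : A.erase a ∉ Q.parts.erase A := by
      intro h
      obtain ⟨b, hb⟩ := Q.nonempty_of_mem_parts (mem_of_mem_erase h)
      grind
    ext t
    grind
  · intros; rfl

open Finset in
/-- Faà di Bruno's formula, with the sum ranging over the partitions of a finite set `s`. -/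
theorem iteratedDeriv_card_comp_eq_sum_finpartition {𝕜 α : Type*} [NontriviallyNormedField 𝕜]
    [DecidableEq α] (s : Finset α) (f g : 𝕜 → 𝕜)
    (hf : ∀ k < #s, Differentiable 𝕜 (iteratedDeriv k f))
    (hg : ∀ k < #s, Differentiable 𝕜 (iteratedDeriv k g)) (x : 𝕜) :
    iteratedDeriv #s (f ∘ g) x =
      ∑ P : Finpartition s, iteratedDeriv #P.parts f (g x) *
        ∏ B ∈ P.parts, iteratedDeriv #B g x := by
  induction s using Finset.induction_on generalizing x with
  | empty =>
    let : Unique (Finpartition (∅ : Finset α)) :=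
      inferInstanceAs (Unique (Finpartition (⊥ : Finset α)))
    have h : (default : Finpartition (∅ : Finset α)).parts = ∅ := rfl
    rw [Fintype.sum_unique, h]
    simp
  | insert a s ha ih =>
    rw [card_insert_of_notMem ha] at hf hg ⊢
    have ih := ih (fun k hk ↦ hf k (by omega)) (fun k hk ↦ hg k (by omega))
    rw [iteratedDeriv_succ, funext ih, Finpartition.sum_insert ha
      (fun p ↦ iteratedDeriv #p f (g x) * ∏ B ∈ p, iteratedDeriv #B g x)]
    have hd {h : 𝕜 → 𝕜} {k : ℕ} (hh : Differentiable 𝕜 (iteratedDeriv k h)) (y : 𝕜) :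
        HasDerivAt (iteratedDeriv k h) (iteratedDeriv (k + 1) h y) y := by
      rw [iteratedDeriv_succ]
      exact (hh y).hasDerivAt
    refine (HasDerivAt.fun_sum fun P _ ↦ ?_).deriv
    have haP : ∀ p ∈ P.parts, a ∉ p := fun p hp hap ↦ ha (P.subset hp hap)
    have hg' : HasDerivAt g (iteratedDeriv 1 g x) x := by
      simpa using hd (hg 0 (by omega)) x
    have hF := (hd (hf #P.parts (Nat.lt_succ_of_le P.card_parts_le_card)) (g x)).comp x hg'
    have hG := HasDerivAt.fun_finsetProd (u := P.parts) fun B hB ↦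
      hd (hg #B (Nat.lt_succ_of_le (card_le_card (P.subset hB)))) x
    refine (hF.mul hG).congr_deriv ?_
    have ha1 : {a} ∉ P.parts := fun h ↦ haP _ h (mem_singleton_self a)
    rw [card_insert_of_notMem ha1, prod_insert ha1, card_singleton, mul_assoc, mul_sum]
    congr 1
    refine sum_congr rfl fun B hB ↦ ?_
    have hn : insert a B ∉ P.parts.erase B := by grind
    rw [card_insert_of_notMem hn, prod_insert hn, card_erase_add_one hB,
      card_insert_of_notMem (haP B hB), smul_eq_mul, mul_comm (iteratedDeriv (#B + 1) g x)]
    rfl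

/-- **Combinatorial Faà di Bruno's formula.** For `n > 0` and `f, g : ℝ → ℝ`
possessing derivatives up to order `n`, the `n`-th derivative of `f ∘ g` is the
sum over all partitions `π` of `{1, …, n}` (modeled as finpartitions of
`Finset.univ : Finset (Fin n)`) of `f^(|π|)(g x) · ∏_{B ∈ π} g^(|B|)(x)`. -/
theorem faa_di_bruno_combinatorial (n : ℕ) (hn : 0 < n) (f g : ℝ → ℝ)
    (hf : ∀ k < n, Differentiable ℝ (iteratedDeriv k f))
    (hg : ∀ k < n, Differentiable ℝ (iteratedDeriv k g)) (x : ℝ) :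
    iteratedDeriv n (f ∘ g) x =
      ∑ π : Finpartition (Finset.univ : Finset (Fin n)),
        iteratedDeriv π.parts.card f (g x) *
          ∏ B ∈ π.parts, iteratedDeriv B.card g x := by
  simpa using iteratedDeriv_card_comp_eq_sum_finpartition (Finset.univ : Finset (Fin n)) f g
    (by simpa using hf) (by simpa using hg) x
end

section
/- Let n > 0 be a natural number, and let f, g : ℝ → ℝ be functions possessing derivatives up to order n. Then the n-th derivative of the composition x ↦ f(g(x)) satisfies: (f ∘ g)⁽ⁿ⁾(x) = ∑ n!/(k₁!·1!^{k₁} ⋯ kₙ!·n!^{kₙ}) · f^(k₁+⋯+kₙ)(g(x)) · ∏_{i=1}^{n} (g^(i)(x))^{k_i}, where the sum ranges over all tuples (k₁, …, kₙ) of nonnegative integers satisfying k₁ + 2k₂ + ⋯ + n·kₙ = n. -/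
section IteratedDeriv

variable {𝕜 : Type*} [NontriviallyNormedField 𝕜] {f g : 𝕜 → 𝕜} {n : ℕ}

/-- **Leibniz rule** for functions that are `n` times differentiable; unlike `iteratedDeriv_mul`,
it does not ask for continuity of the `n`-th derivatives. -/
theorem iteratedDeriv_mul_of_differentiable
    (hf : ∀ k < n, Differentiable 𝕜 (iteratedDeriv k f))
    (hg : ∀ k < n, Differentiable 𝕜 (iteratedDeriv k g)) (x : 𝕜) :
    iteratedDeriv n (f * g) x =
      ∑ i ∈ Finset.range (n + 1),
        (n.choose i : 𝕜) * (iteratedDeriv i f x * iteratedDeriv (n - i) g x) := by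
  induction n generalizing x with
  | zero => simp
  | succ n ih =>
    have key := ih (fun k hk => hf k (by omega)) (fun k hk => hg k (by omega))
    rw [iteratedDeriv_succ, funext key,
      Finset.sum_choose_succ_mul fun i j => iteratedDeriv i f x * iteratedDeriv j g x,
      ← Finset.sum_add_distrib]
    refine (HasDerivAt.fun_sum fun i hi => ?_).deriv
    have hi' : i ≤ n := Finset.mem_range_succ_iff.1 hi
    have hfi := (hf i (by omega) x).hasDerivAt
    have hgi := (hg (n - i) (by omega) x).hasDerivAt
    rw [← iteratedDeriv_succ] at hfi hgi
    rw [← Nat.sub_add_comm hi'] at hgi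
    exact ((hfi.mul hgi).const_mul _).congr_deriv (by ring)

theorem differentiable_iteratedDeriv_mul
    (hf : ∀ k < n, Differentiable 𝕜 (iteratedDeriv k f))
    (hg : ∀ k < n, Differentiable 𝕜 (iteratedDeriv k g)) :
    ∀ k < n, Differentiable 𝕜 (iteratedDeriv k (f * g)) := by
  intro k hk
  rw [funext (iteratedDeriv_mul_of_differentiable (fun j hj => hf j (hj.trans hk))
    fun j hj => hg j (hj.trans hk))]
  refine Differentiable.fun_sum fun i hi => ?_
  have hi' : i ≤ k := Finset.mem_range_succ_iff.1 hi
  exact ((hf i (by omega)).mul (hg (k - i) (by omega))).const_mul _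

theorem differentiable_iteratedDeriv_deriv
    (hf : ∀ k < n + 1, Differentiable 𝕜 (iteratedDeriv k f)) :
    ∀ k < n, Differentiable 𝕜 (iteratedDeriv k (deriv f)) := fun k hk => by
  simpa only [iteratedDeriv_succ'] using hf (k + 1) (by omega)

theorem deriv_comp_eq_mul (hf : Differentiable 𝕜 f) (hg : Differentiable 𝕜 g) :
    deriv (f ∘ g) = deriv g * (deriv f ∘ g) := by
  ext x
  rw [deriv_comp x (hf _) (hg x), mul_comm]
  rfl

theorem differentiable_iteratedDeriv_comp
    (hf : ∀ k < n, Differentiable 𝕜 (iteratedDeriv k f))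
    (hg : ∀ k < n, Differentiable 𝕜 (iteratedDeriv k g)) :
    ∀ k < n, Differentiable 𝕜 (iteratedDeriv k (f ∘ g)) := by
  induction n generalizing f with
  | zero => simp
  | succ n ih =>
    have hf₀ : Differentiable 𝕜 f := by simpa using hf 0 (by omega)
    have hg₀ : Differentiable 𝕜 g := by simpa using hg 0 (by omega)
    intro k hk
    cases k with
    | zero => simpa using hf₀.comp hg₀
    | succ k =>
      rw [iteratedDeriv_succ', deriv_comp_eq_mul hf₀ hg₀]
      exact differentiable_iteratedDeriv_mul (differentiable_iteratedDeriv_deriv hg)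
        (ih (differentiable_iteratedDeriv_deriv hf) fun k hk => hg k (by omega)) k (by omega)

end IteratedDeriv

namespace FaaDiBruno

/-- The tuples `(k₁, …, k_N)` with `k₁ + 2k₂ + ⋯ + N·k_N = n` and all entries at most `N`. -/
def index (N n : ℕ) : Finset (Fin N → ℕ) :=
  (Fintype.piFinset fun _ : Fin N => Finset.range (N + 1)).filter
    fun k => ∑ i : Fin N, ((i : ℕ) + 1) * k i = n

theorem mem_index {N n : ℕ} (h : n ≤ N) (k : Fin N → ℕ) :
    k ∈ index N n ↔ ∑ i : Fin N, ((i : ℕ) + 1) * k i = n := by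
  simp only [index, Finset.mem_filter, Fintype.mem_piFinset, Finset.mem_range_succ_iff,
    and_iff_right_iff_imp]
  rintro hk i
  calc k i ≤ ((i : ℕ) + 1) * k i := Nat.le_mul_of_pos_left _ (Nat.succ_pos _)
    _ ≤ ∑ i : Fin N, ((i : ℕ) + 1) * k i :=
      Finset.single_le_sum (f := fun i : Fin N => ((i : ℕ) + 1) * k i)
        (fun _ _ => Nat.zero_le _) (Finset.mem_univ i)
    _ ≤ N := hk.trans_le h

variable {K : Type*} [Field K]

/-- The monomial `∏ yᵢ ^ kᵢ / kᵢ!` with divided powers. -/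
def weight {N : ℕ} (y : ℕ → K) (k : Fin N → ℕ) : K :=
  ∏ i : Fin N, y i ^ k i / (k i).factorial

theorem sum_mul_add_single {N : ℕ} (k c : Fin N → ℕ) (j : Fin N) :
    ∑ i, c i * (k + Pi.single j 1 : Fin N → ℕ) i = ∑ i, c i * k i + c j := by
  simp [mul_add, Finset.sum_add_distrib, Pi.single_apply]

theorem weight_add_single [CharZero K] {N : ℕ} (y : ℕ → K) (k : Fin N → ℕ) (j : Fin N) :
    ((k j : K) + 1) * weight y (k + Pi.single j 1) = y j * weight y k := by
  unfold weight
  rw [← Finset.mul_prod_erase _ _ (Finset.mem_univ j),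
    ← Finset.mul_prod_erase _ _ (Finset.mem_univ j), ← mul_assoc, ← mul_assoc]
  congr 1
  · have h₁ : (k j : K) + 1 ≠ 0 := Nat.cast_add_one_ne_zero _
    have h₂ : ((k j).factorial : K) ≠ 0 := Nat.cast_ne_zero.2 (Nat.factorial_ne_zero _)
    simp only [Pi.add_apply, Pi.single_eq_same, Nat.factorial_succ, pow_succ]
    push_cast
    field_simp
  · refine Finset.prod_congr rfl fun i hi => ?_
    simp [Pi.single_eq_of_ne (Finset.ne_of_mem_erase hi)]

/-- The weighted sum in Faà di Bruno's formula, divided by `n!`. -/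
def bellSum (N : ℕ) (y a : ℕ → K) (n : ℕ) : K :=
  ∑ k ∈ index N n, a (∑ i, k i) * weight y k

theorem sum_index_mul_weight [CharZero K] {N n : ℕ} (hn : n + 1 ≤ N) (y a : ℕ → K) (j : Fin N) :
    ∑ k ∈ index N (n + 1), (k j : K) * (a (∑ i, k i) * weight y k) =
      if (j : ℕ) ≤ n then y j * bellSum N y (fun m => a (m + 1)) (n - j) else 0 := by
  have hsub : ∀ k : Fin N → ℕ, k j ≠ 0 → k - Pi.single j 1 + Pi.single j 1 = k := by
    intro k hk
    refine tsub_add_cancel_of_le fun i => ?_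
    rcases eq_or_ne i j with rfl | hij
    · simpa using Nat.one_le_iff_ne_zero.2 hk
    · simp [Pi.single_eq_of_ne hij]
  have hle : ∀ k ∈ index N (n + 1), k j ≠ 0 → (j : ℕ) ≤ n ∧
      ∑ i : Fin N, ((i : ℕ) + 1) * (k - Pi.single j 1 : Fin N → ℕ) i = n - j := by
    intro k hk hkj
    have h := (mem_index hn k).1 hk
    rw [← hsub k hkj, sum_mul_add_single _ fun i : Fin N => (i : ℕ) + 1] at h
    omega
  split_ifs with hj
  · rw [bellSum, Finset.mul_sum, ← Finset.sum_filter_of_ne (p := fun k => k j ≠ 0)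
      fun k _ h h₀ => h (by simp [h₀])]
    symm
    refine Finset.sum_bij' (fun k _ => k + Pi.single j 1) (fun k _ => k - Pi.single j 1)
      (fun k hk => ?_) (fun k hk => ?_) (fun k hk => ?_) (fun k hk => ?_) fun k hk => ?_
    · rw [mem_index (by omega)] at hk
      rw [Finset.mem_filter, mem_index hn, sum_mul_add_single _ fun i : Fin N => (i : ℕ) + 1]
      exact ⟨by omega, by simp⟩
    · rw [Finset.mem_filter] at hk
      exact (mem_index (by omega) _).2 (hle k hk.1 hk.2).2
    · exact add_tsub_cancel_right _ _
    · exact hsub k (Finset.mem_filter.1 hk).2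
    · have hs := sum_mul_add_single k (fun _ => 1) j
      simp only [one_mul] at hs
      have hw := weight_add_single y k j
      rw [hs, Pi.add_apply, Pi.single_eq_same]
      push_cast
      linear_combination -a (∑ i, k i + 1) * hw
  · refine Finset.sum_eq_zero fun k hk => ?_
    have : k j = 0 := by
      by_contra h
      exact hj (hle k hk h).1
    simp [this]

theorem bellSum_zero (N : ℕ) (y a : ℕ → K) : bellSum N y a 0 = a 0 := by
  have : index N 0 = {0} := by
    ext k
    simp [mem_index, funext_iff]
  simp [bellSum, this, weight]

theorem bellSum_succ [CharZero K] {N n : ℕ} (hn : n + 1 ≤ N) (y a : ℕ → K) :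
    ((n : K) + 1) * bellSum N y a (n + 1) =
      ∑ j ∈ Finset.range (n + 1),
        ((j : K) + 1) * (y j * bellSum N y (fun m => a (m + 1)) (n - j)) := by
  have hmul : ∀ k ∈ index N (n + 1), ((n : K) + 1) * (a (∑ i, k i) * weight y k) =
      ∑ j : Fin N, ((j : K) + 1) * ((k j : K) * (a (∑ i, k i) * weight y k)) := by
    intro k hk
    have h := congrArg (Nat.cast (R := K)) ((mem_index hn k).1 hk)
    push_cast at h
    rw [← h, Finset.sum_mul]
    simp only [mul_assoc]
  rw [bellSum, Finset.mul_sum, Finset.sum_congr rfl hmul, Finset.sum_comm]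
  simp only [← Finset.mul_sum, sum_index_mul_weight hn]
  rw [Fin.sum_univ_eq_sum_range (fun j => ((j : K) + 1) *
    if j ≤ n then y j * bellSum N y (fun m => a (m + 1)) (n - j) else 0) N]
  rw [← Finset.sum_subset (Finset.range_mono hn)]
  · refine Finset.sum_congr rfl fun j hj => ?_
    rw [if_pos (Finset.mem_range_succ_iff.1 hj)]
  · intro j _ hj
    rw [if_neg (mt Finset.mem_range_succ_iff.2 hj), mul_zero]

theorem iteratedDeriv_comp_eq_bellSum {𝕜 : Type*} [NontriviallyNormedField 𝕜] [CharZero 𝕜]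
    {N n : ℕ} (hn : n ≤ N) {f g : 𝕜 → 𝕜}
    (hf : ∀ k < n, Differentiable 𝕜 (iteratedDeriv k f))
    (hg : ∀ k < n, Differentiable 𝕜 (iteratedDeriv k g)) (x : 𝕜) :
    iteratedDeriv n (f ∘ g) x =
      n.factorial * bellSum N (fun i => iteratedDeriv (i + 1) g x / (i + 1).factorial)
        (fun m => iteratedDeriv m f (g x)) n := by
  induction n using Nat.strong_induction_on generalizing f with
  | _ n ih =>
  cases n with
  | zero => simp [bellSum_zero]
  | succ n =>
    have hf' := differentiable_iteratedDeriv_deriv hf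
    have hg' := differentiable_iteratedDeriv_deriv hg
    rw [iteratedDeriv_succ', deriv_comp_eq_mul (by simpa using hf 0 (by omega))
      (by simpa using hg 0 (by omega)), iteratedDeriv_mul_of_differentiable hg'
      (differentiable_iteratedDeriv_comp hf' fun k hk => hg k (by omega)),
      Nat.factorial_succ, mul_comm (n + 1), Nat.cast_mul, mul_assoc, Nat.cast_succ,
      bellSum_succ hn, Finset.mul_sum]
    refine Finset.sum_congr rfl fun j hj => ?_
    have hj' : j ≤ n := Finset.mem_range_succ_iff.1 hj
    rw [ih (n - j) (by omega) (by omega) (fun k hk => hf' k (by omega))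
      fun k hk => hg k (by omega), ← Nat.choose_mul_factorial_mul_factorial hj']
    simp only [← iteratedDeriv_succ', Nat.factorial_succ]
    have h₁ : (j : 𝕜) + 1 ≠ 0 := Nat.cast_add_one_ne_zero _
    have h₂ : (j.factorial : 𝕜) ≠ 0 := Nat.cast_ne_zero.2 (Nat.factorial_ne_zero _)
    push_cast
    field_simp

end FaaDiBruno


/-- **Faà di Bruno's formula (classical form).** For `n > 0` and `f, g : ℝ → ℝ`
possessing derivatives up to order `n`,
`(f ∘ g)⁽ⁿ⁾(x) = ∑ n!/(k₁!·1!^{k₁} ⋯ kₙ!·n!^{kₙ}) · f^(k₁+⋯+kₙ)(g x) · ∏ᵢ (g⁽ⁱ⁾ x)^{kᵢ}`,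
where the sum is over tuples `(k₁, …, kₙ)` of nonnegative integers with
`k₁ + 2k₂ + ⋯ + n·kₙ = n` (every such solution satisfies `kᵢ ≤ n`, so they all
lie in the finite index set used below). Here `k : Fin n → ℕ` records `kᵢ = k ⟨i-1⟩`. -/
theorem faa_di_bruno_classical (n : ℕ) (hn : 0 < n) (f g : ℝ → ℝ)
    (hf : ∀ k < n, Differentiable ℝ (iteratedDeriv k f))
    (hg : ∀ k < n, Differentiable ℝ (iteratedDeriv k g)) (x : ℝ) :
    iteratedDeriv n (f ∘ g) x =
      ∑ k ∈ (Fintype.piFinset fun _ : Fin n => Finset.range (n + 1)).filter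
          (fun k => ∑ i : Fin n, ((i : ℕ) + 1) * k i = n),
        ((n.factorial : ℝ) /
            ∏ i : Fin n, ((k i).factorial * ((i : ℕ) + 1).factorial ^ (k i))) *
          iteratedDeriv (∑ i : Fin n, k i) f (g x) *
          ∏ i : Fin n, (iteratedDeriv ((i : ℕ) + 1) g x) ^ (k i) := by
  rw [FaaDiBruno.iteratedDeriv_comp_eq_bellSum le_rfl hf hg x, FaaDiBruno.bellSum,
    FaaDiBruno.index, Finset.mul_sum]
  refine Finset.sum_congr rfl fun k _ => ?_
  simp only [FaaDiBruno.weight, div_pow, Finset.prod_div_distrib, Finset.prod_mul_distrib]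
  field_simp
  push_cast
  ring
end
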